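/- arXiv:2411.04874 — 2 statements merged into one kernel-verified Lean document; each statement's English description precedes it below -/
import Mathlib

section
/- For every n ≥ 1 and all indices 0 ≤ i ≤ j ≤ 4n, the timestep strings satisfy hammingDist(t_i, t_j) ≥ j − i; that is, t_i and t_j differ in at least j − i coordinates. -/
/-- The timestep string `t_i ∈ {0,1}^{4n+2}`: the unary string `1^i 0^{4n−i}`
followed by two bits `(a_i, b_i)` with `(a_i, b_i) = (0,0), (1,0), (1,1), (0,1)`
according to `i ≡ 0, 1, 2, 3 (mod 4)` respectively. -/
def timestep (n i : ℕ) : Fin (4 * n + 2) → Bool := fun j =>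
  if (j : ℕ) < 4 * n then decide ((j : ℕ) < i)
  else if (j : ℕ) = 4 * n then decide (i % 4 = 1 ∨ i % 4 = 2)
  else decide (i % 4 = 2 ∨ i % 4 = 3)

/-- For all `0 ≤ i ≤ j ≤ 4n`, the timestep strings `t_i` and `t_j` differ in at least
`j − i` coordinates. -/
theorem hammingDist_timestep_ge (n : ℕ) (hn : 1 ≤ n) (i j : ℕ)
    (hij : i ≤ j) (hj : j ≤ 4 * n) :
    j - i ≤ hammingDist (timestep n i) (timestep n j) := by
  have hlt : ∀ k ∈ Finset.Ico i j, k < 4 * n + 2 := fun k hk => by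
    have := (Finset.mem_Ico.mp hk).2
    omega
  calc j - i = ((Finset.Ico i j).attachFin hlt).card := by
        rw [Finset.card_attachFin, Nat.card_Ico]
    _ ≤ hammingDist (timestep n i) (timestep n j) := by
        refine Finset.card_le_card fun k hk => ?_
        obtain ⟨hik, hkj⟩ := Finset.mem_Ico.mp (Finset.mem_attachFin hlt |>.mp hk)
        have hk4 : (k : ℕ) < 4 * n := by omega
        simp [timestep, hk4, hkj, hik]
end

section
/- (Classical soundness of the amplified clock construction) Let n ≥ 1, w ≥ 1 and 1 ≤ g' ≤ n. Consider assignments s = (B, F, G, K, L, M) with B, F, G ∈ {0,1}^n, K ∈ {0,1}^{4n}, L ∈ {0,1}², M ∈ {0,1}^w. Suppose s₀, s₁, …, s_T is a sequence of assignments such that: s₀ is the all-zeros assignment; each s_{j+1} is obtained from s_j by flipping at most two bits; every s_j is valid (satisfies all the constraints listed in the context); and the final assignment s_T has Hamming weight of B at least g' and K_{4n} = 1. Then T ≥ g'·w. -/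
/-- An assignment `(B, F, G, K, L, M) ∈ {0,1}^n × {0,1}^n × {0,1}^n × {0,1}^{4n} ×
{0,1}² × {0,1}^w`. -/
structure ClAsn (n w : ℕ) where
  B : Fin n → Bool
  F : Fin n → Bool
  G : Fin n → Bool
  K : Fin (4 * n) → Bool
  L : Bool × Bool
  M : Fin w → Bool

namespace ClAsn

variable {n w : ℕ}

/-- 1-indexed access to `K`: `kb s i = K_i` for `1 ≤ i ≤ 4n`. -/
def kb (s : ClAsn n w) (i : ℕ) : Bool :=
  if h : 1 ≤ i ∧ i ≤ 4 * n then s.K ⟨i - 1, by omega⟩ else false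

/-- 1-indexed access to `B`: `bb s i = B_i` for `1 ≤ i ≤ n`. -/
def bb (s : ClAsn n w) (i : ℕ) : Bool :=
  if h : 1 ≤ i ∧ i ≤ n then s.B ⟨i - 1, by omega⟩ else false

/-- 1-indexed access to `F`. -/
def fb (s : ClAsn n w) (i : ℕ) : Bool :=
  if h : 1 ≤ i ∧ i ≤ n then s.F ⟨i - 1, by omega⟩ else false

/-- 1-indexed access to `G`. -/
def gb (s : ClAsn n w) (i : ℕ) : Bool :=
  if h : 1 ≤ i ∧ i ≤ n then s.G ⟨i - 1, by omega⟩ else false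

/-- The first coordinate `M₁` of the amplification register. -/
def m1 (s : ClAsn n w) : Bool :=
  if h : 0 < w then s.M ⟨0, h⟩ else false

/-- Validity of an assignment: constraints (a)–(f). -/
def Valid (s : ClAsn n w) : Prop :=
  -- (a) K is unary-ordered
  (∀ i : ℕ, 1 ≤ i → i + 1 ≤ 4 * n → ¬(s.kb i = false ∧ s.kb (i + 1) = true)) ∧
  -- (b) L is determined by the frontier of K
  (s.kb 1 = false → s.L = (false, false)) ∧
  (∀ i : ℕ, 1 ≤ i → i ≤ n →
    ((s.kb (4 * i - 3) = true ∧ s.kb (4 * i - 2) = false) → s.L = (true, false)) ∧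
    ((s.kb (4 * i - 2) = true ∧ s.kb (4 * i - 1) = false) → s.L = (true, true)) ∧
    ((s.kb (4 * i - 1) = true ∧ s.kb (4 * i) = false) → s.L = (false, true))) ∧
  (∀ i : ℕ, 1 ≤ i → i + 1 ≤ n →
    (s.kb (4 * i) = true ∧ s.kb (4 * i + 1) = false) → s.L = (false, false)) ∧
  (s.kb (4 * n) = true → s.L = (false, false)) ∧
  -- (c) in phases 10 and 01 the amplification register is constant
  ((s.L = (true, false) ∨ s.L = (false, true)) → ∀ i j : Fin w, s.M i = s.M j) ∧
  -- (d) in phase 01 all amplification bits are 0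
  (∀ i : ℕ, 1 ≤ i → i ≤ n →
    (s.kb (4 * i - 1) = true ∧ s.kb (4 * i) = false) → s.m1 = false) ∧
  -- (e) the three proof copies agree outside their dedicated timestep
  (¬(s.kb 1 = false ∧ s.kb 2 = false) → s.bb 1 = s.fb 1 ∧ s.bb 1 = s.gb 1) ∧
  (∀ i : ℕ, 1 ≤ i → i + 1 ≤ n → ¬(s.kb (4 * i) = true ∧ s.kb (4 * i + 1) = false) →
    s.bb (i + 1) = s.fb (i + 1) ∧ s.bb (i + 1) = s.gb (i + 1)) ∧
  -- (f) the prepared proof bit matches the amplification register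
  (∀ i : ℕ, i + 1 ≤ n →
    (s.kb (4 * i + 1) = true ∧ s.kb (4 * i + 2) = false) → s.bb (i + 1) = s.m1)

/-- The number of bits on which two assignments differ. -/
def flips (s t : ClAsn n w) : ℕ :=
  hammingDist s.B t.B + hammingDist s.F t.F + hammingDist s.G t.G +
    hammingDist s.K t.K + (if s.L.1 = t.L.1 then 0 else 1) +
    (if s.L.2 = t.L.2 then 0 else 1) + hammingDist s.M t.M

/-- The all-zeros assignment. -/
def zero (n w : ℕ) : ClAsn n w :=
  ⟨fun _ => false, fun _ => false, fun _ => false, fun _ => false,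
    (false, false), fun _ => false⟩

end ClAsn

/-- A sequence of naturals that grows by at most one per step and reaches at least `c` takes the
value `c` at a time after which it never drops below `c`. -/
theorem exists_last_visit {p : ℕ → ℕ} {T a c : ℕ} (haT : a ≤ T)
    (hp : ∀ j, j < T → p (j + 1) ≤ p j + 1) (ha : p a ≤ c) (hT : c ≤ p T) :
    ∃ t, a ≤ t ∧ t ≤ T ∧ p t = c ∧ ∀ u, t ≤ u → u ≤ T → c ≤ p u := by
  induction T, haT using Nat.le_induction with
  | base =>
    refine ⟨a, le_rfl, le_rfl, le_antisymm ha hT, fun u h1 h2 => ?_⟩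
    rwa [le_antisymm h2 h1]
  | succ T haT ih =>
    by_cases hc : c ≤ p T
    · obtain ⟨t, h1, h2, h3, h4⟩ := ih (fun j hj => hp j (by omega)) hc
      refine ⟨t, h1, by omega, h3, fun u hu hu' => ?_⟩
      rcases Nat.lt_or_ge T u with h | h
      · rwa [show u = T + 1 by omega]
      · exact h4 u hu h
    · have := hp T (by omega)
      refine ⟨T + 1, by omega, le_rfl, by omega, fun u hu hu' => ?_⟩
      rwa [show u = T + 1 by omega]

/-- A Boolean sequence in which no `false` is directly followed by `true` consists of a block of
`true`s, whose length is the number of `true`s, followed by `false`s. -/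
theorem eq_true_iff_lt_card_of_unary {N : ℕ} {f : Fin N → Bool}
    (hf : ∀ (i : ℕ) (hi : i + 1 < N), f ⟨i + 1, hi⟩ = true → f ⟨i, by omega⟩ = true)
    (i : Fin N) : f i = true ↔ (i : ℕ) < (Finset.univ.filter fun x => f x = true).card := by
  have down : ∀ (b : ℕ) (hb : b < N), f ⟨b, hb⟩ = true →
      ∀ (a : ℕ) (hab : a ≤ b), f ⟨a, by omega⟩ = true := by
    intro b
    induction b with
    | zero =>
      intro hb h a hab
      obtain rfl : a = 0 := by omega
      exact h
    | succ b ih =>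
      intro hb h a hab
      rcases Nat.lt_or_ge b a with h' | h'
      · obtain rfl : a = b + 1 := by omega
        exact h
      · exact ih _ (hf b hb h) a h'
  constructor
  · intro h
    have hsub : Finset.Iic i ⊆ Finset.univ.filter fun x => f x = true := fun x hx => by
      simpa using down i i.2 h x (by simpa using hx)
    simpa using Finset.card_le_card hsub
  · intro h
    by_contra hi
    have hsub : (Finset.univ.filter fun x => f x = true) ⊆ Finset.Iio i := fun x hx => by
      by_contra hxi
      exact hi (down x x.2 (by simpa using hx) i (by simpa using hxi))
    have := Finset.card_le_card hsub
    simp only [Fin.card_Iio] at this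
    omega

/-- The number of `true`s changes by at most the Hamming distance. -/
theorem card_true_le_add_hammingDist {ι : Type*} [Fintype ι] [DecidableEq ι] (f g : ι → Bool) :
    (Finset.univ.filter fun i => f i = true).card ≤
      (Finset.univ.filter fun i => g i = true).card + hammingDist f g := by
  unfold hammingDist
  refine (Finset.card_le_card ?_).trans (Finset.card_union_le _ _)
  intro i hi
  simp only [Finset.mem_filter, Finset.mem_univ, true_and, Finset.mem_union] at hi ⊢
  by_cases h : g i = true
  · exact Or.inl h
  · exact Or.inr fun e => h (e ▸ hi)

/-- Along a sequence with steps of Hamming length at most two, the distance between two times is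
at most twice the elapsed time. -/
theorem hammingDist_le_two_mul_sub {ι : Type*} [Fintype ι] {x : ℕ → ι → Bool} {T a b : ℕ}
    (hx : ∀ j, j < T → hammingDist (x j) (x (j + 1)) ≤ 2) (hab : a ≤ b) (hb : b ≤ T) :
    hammingDist (x a) (x b) ≤ 2 * (b - a) := by
  induction b, hab using Nat.le_induction with
  | base => simp
  | succ b hab ih =>
    have h1 := ih (by omega)
    have h2 := hx b (by omega)
    have h3 := hammingDist_triangle (x a) (x b) (x (b + 1))
    omega

theorem hammingDist_const_of_ne {ι : Type*} [Fintype ι] {a b : Bool} (h : a ≠ b) :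
    hammingDist (fun _ : ι => a) (fun _ => b) = Fintype.card ι := by
  simp [hammingDist, h]

namespace ClAsn

variable {n w : ℕ}

/-- The clock position: the number of ones in `K`. -/
def pos (s : ClAsn n w) : ℕ := (Finset.univ.filter fun i => s.K i = true).card

theorem Valid.kb_iff {s : ClAsn n w} (hs : s.Valid) {i : ℕ} (h1 : 1 ≤ i) (h2 : i ≤ 4 * n) :
    s.kb i = true ↔ i ≤ s.pos := by
  have key := eq_true_iff_lt_card_of_unary (f := s.K) (fun j hj h => by
    have := hs.1 (j + 1) (by omega) (by omega)
    simp only [kb] at this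
    rw [dif_pos (by omega), dif_pos (by omega)] at this
    by_contra hc
    exact this ⟨by simpa using hc, by simpa using h⟩) ⟨i - 1, by omega⟩
  rw [kb, dif_pos ⟨h1, h2⟩, key, pos]
  show i - 1 < _ ↔ _
  omega

theorem Valid.kb_eq_false_iff {s : ClAsn n w} (hs : s.Valid) {i : ℕ} (h1 : 1 ≤ i)
    (h2 : i ≤ 4 * n) : s.kb i = false ↔ s.pos < i := by
  rw [← Bool.not_eq_true, hs.kb_iff h1 h2, not_le]

theorem pos_le (s : ClAsn n w) : s.pos ≤ 4 * n := by
  simpa [pos] using Finset.card_le_univ (Finset.univ.filter fun i => s.K i = true)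

/-- The phase register is the Gray code of the clock position modulo four. -/
theorem Valid.L_eq {s : ClAsn n w} (hs : s.Valid) (hn : 1 ≤ n) :
    s.L = (decide (s.pos % 4 = 1 ∨ s.pos % 4 = 2), decide (s.pos % 4 = 2 ∨ s.pos % 4 = 3)) := by
  have hle := s.pos_le
  obtain ⟨-, hb0, hb, hb4, hbn, -⟩ := id hs
  obtain ⟨q, hq⟩ : ∃ q, q = s.pos / 4 := ⟨_, rfl⟩
  have hr : s.pos % 4 = 0 ∨ s.pos % 4 = 1 ∨ s.pos % 4 = 2 ∨ s.pos % 4 = 3 := by omega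
  rcases hr with h | h | h | h
  · have : s.L = (false, false) := by
      rcases Nat.eq_zero_or_pos q with h0 | h0
      · exact hb0 ((hs.kb_eq_false_iff le_rfl (by omega)).2 (by omega))
      rcases Nat.lt_or_ge q n with h' | h'
      · exact hb4 q h0 h' ⟨(hs.kb_iff (by omega) (by omega)).2 (by omega),
          (hs.kb_eq_false_iff (by omega) (by omega)).2 (by omega)⟩
      · exact hbn ((hs.kb_iff (by omega) (by omega)).2 (by omega))
    simp [this, h]
  · have := (hb (q + 1) (by omega) (by omega)).1
      ⟨(hs.kb_iff (by omega) (by omega)).2 (by omega),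
        (hs.kb_eq_false_iff (by omega) (by omega)).2 (by omega)⟩
    simp [this, h]
  · have := (hb (q + 1) (by omega) (by omega)).2.1
      ⟨(hs.kb_iff (by omega) (by omega)).2 (by omega),
        (hs.kb_eq_false_iff (by omega) (by omega)).2 (by omega)⟩
    simp [this, h]
  · have := (hb (q + 1) (by omega) (by omega)).2.2
      ⟨(hs.kb_iff (by omega) (by omega)).2 (by omega),
        (hs.kb_eq_false_iff (by omega) (by omega)).2 (by omega)⟩
    simp [this, h]

theorem M_eq_m1 {s : ClAsn n w} (h : ∀ i j : Fin w, s.M i = s.M j) : s.M = fun _ => s.m1 := by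
  funext i
  rw [m1, dif_pos i.pos]
  exact h _ _

/-- Right after the `i`-th proof bit is fixed, the amplification register repeats it. -/
theorem Valid.M_eq_of_pos_eq_one {s : ClAsn n w} (hs : s.Valid) {i : Fin n}
    (hp : s.pos = 4 * (i : ℕ) + 1) : s.M = fun _ => s.B i := by
  have hi := i.2
  have hL := hs.L_eq (by omega)
  obtain ⟨-, -, -, -, -, hc, -, -, -, hf⟩ := id hs
  rw [M_eq_m1 (hc (Or.inl (by rw [hL, hp]; simp [Nat.add_mod])))]
  have := hf i (by omega) ⟨(hs.kb_iff (by omega) (by omega)).2 (by omega),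
    (hs.kb_eq_false_iff (by omega) (by omega)).2 (by omega)⟩
  rw [← this, bb, dif_pos (by omega)]
  rfl

/-- At the end of each block the amplification register is cleared. -/
theorem Valid.M_eq_of_pos_eq_three {s : ClAsn n w} (hs : s.Valid) {i : ℕ} (hi : i < n)
    (hp : s.pos = 4 * i + 3) : s.M = fun _ => false := by
  have hL := hs.L_eq (by omega)
  obtain ⟨-, -, -, -, -, hc, hd, -⟩ := id hs
  rw [M_eq_m1 (hc (Or.inr (by rw [hL, hp]; simp [Nat.add_mod])))]
  rw [hd (i + 1) (by omega) (by omega) ⟨(hs.kb_iff (by omega) (by omega)).2 (by omega),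
    (hs.kb_eq_false_iff (by omega) (by omega)).2 (by omega)⟩]

/-- The copies of a proof bit agree after its dedicated timestep. -/
theorem Valid.copies_eq {s : ClAsn n w} (hs : s.Valid) {i : Fin n} (hp : 4 * (i : ℕ) < s.pos) :
    s.B i = s.F i ∧ s.B i = s.G i := by
  have hi := i.2
  obtain ⟨-, -, -, -, -, -, -, he0, he, -⟩ := id hs
  have key : s.bb (i + 1) = s.fb (i + 1) ∧ s.bb (i + 1) = s.gb (i + 1) := by
    rcases Nat.eq_zero_or_pos (i : ℕ) with h0 | h0
    · rw [h0]
      refine he0 fun h => ?_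
      have := (hs.kb_eq_false_iff (by omega) (by omega)).1 h.1
      omega
    · refine he i h0 (by omega) fun h => ?_
      have := (hs.kb_eq_false_iff (by omega) (by omega)).1 h.2
      omega
  simpa [bb, fb, gb, Nat.succ_le_iff] using key

theorem pos_succ_le {s t : ClAsn n w} (hn : 1 ≤ n) (hs : s.Valid) (ht : t.Valid)
    (h : flips s t ≤ 2) : t.pos ≤ s.pos + 1 := by
  have hK : t.pos ≤ s.pos + hammingDist t.K s.K := card_true_le_add_hammingDist t.K s.K
  rw [hammingDist_comm] at hK
  unfold flips at h
  by_contra hc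
  have hp : t.pos = s.pos + 2 := by omega
  have h1 : s.L.1 = t.L.1 := by
    by_contra h'
    rw [if_neg h'] at h
    omega
  have h2 : s.L.2 = t.L.2 := by
    by_contra h'
    rw [if_neg h'] at h
    omega
  rw [hs.L_eq hn, ht.L_eq hn] at h1 h2
  simp only [decide_eq_decide] at h1 h2
  omega

theorem B_eq_of_flips_le {s t : ClAsn n w} (hs : s.Valid) (ht : t.Valid) (h : flips s t ≤ 2)
    {i : Fin n} (his : 4 * (i : ℕ) < s.pos) (hit : 4 * (i : ℕ) < t.pos) : s.B i = t.B i := by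
  by_contra hB
  obtain ⟨hsF, hsG⟩ := hs.copies_eq his
  obtain ⟨htF, htG⟩ := ht.copies_eq hit
  have h1 : 0 < hammingDist s.B t.B := hammingDist_pos.2 fun e => hB (congrFun e i)
  have h2 : 0 < hammingDist s.F t.F :=
    hammingDist_pos.2 fun e => hB (by rw [hsF, htF]; exact congrFun e i)
  have h3 : 0 < hammingDist s.G t.G :=
    hammingDist_pos.2 fun e => hB (by rw [hsG, htG]; exact congrFun e i)
  unfold flips at h
  omega

end ClAsn

/-- After the last visit to the end of block `k`, the time spent is at least `w` for every proof
bit among the first `k` that is finally one. -/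
theorem exists_cleared_time {n w T : ℕ} (hn : 1 ≤ n) {s : ℕ → ClAsn n w}
    (h0 : s 0 = ClAsn.zero n w)
    (hstep : ∀ j : ℕ, j < T → ClAsn.flips (s j) (s (j + 1)) ≤ 2)
    (hvalid : ∀ j : ℕ, j ≤ T → (s j).Valid) (hfinal : (s T).pos = 4 * n) (k : ℕ) (hk : k ≤ n) :
    ∃ t, t ≤ T ∧ (s t).pos ≤ 4 * k ∧ (s t).M = (fun _ => false) ∧
      (Finset.univ.filter fun i : Fin n => (s T).B i = true ∧ (i : ℕ) < k).card * w ≤ t := by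
  have hp : ∀ j, j < T → (s (j + 1)).pos ≤ (s j).pos + 1 := fun j hj =>
    ClAsn.pos_succ_le hn (hvalid j (by omega)) (hvalid _ hj) (hstep j hj)
  have hM : ∀ j, j < T → hammingDist (s j).M (s (j + 1)).M ≤ 2 := fun j hj => by
    have := hstep j hj
    unfold ClAsn.flips at this
    omega
  induction k with
  | zero =>
    exact ⟨0, by omega, by simp [h0, ClAsn.zero, ClAsn.pos], by simp [h0, ClAsn.zero], by simp⟩
  | succ k ih =>
    obtain ⟨t, htT, htp, htM, htw⟩ := ih (by omega)
    obtain ⟨a, hta, haT, hap, halast⟩ := exists_last_visit (p := fun j => (s j).pos)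
      (c := 4 * k + 1) htT hp (by omega) (by omega)
    obtain ⟨b, hab, hbT, hbp, -⟩ := exists_last_visit (p := fun j => (s j).pos)
      (c := 4 * k + 3) haT hp (by omega) (by omega)
    have hbM := (hvalid b hbT).M_eq_of_pos_eq_three (by omega) hbp
    refine ⟨b, hbT, by omega, hbM, ?_⟩
    have hB : ∀ u, a ≤ u → u ≤ T → (s u).B ⟨k, hk⟩ = (s a).B ⟨k, hk⟩ := by
      intro u hu
      induction u, hu using Nat.le_induction with
      | base => exact fun _ => rfl
      | succ u hu ih =>
        intro huT
        rw [← ih (by omega)]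
        have h1 := halast u hu (by omega)
        have h2 := halast (u + 1) (by omega) huT
        exact (ClAsn.B_eq_of_flips_le (hvalid u (by omega)) (hvalid _ huT) (hstep u huT)
          (i := ⟨k, hk⟩) (by grind) (by grind)).symm
    have haM := (hvalid a haT).M_eq_of_pos_eq_one (i := ⟨k, hk⟩) hap
    rw [← hB T haT le_rfl] at haM
    by_cases hBk : (s T).B ⟨k, hk⟩ = true
    · have hins : (Finset.univ.filter fun i : Fin n => (s T).B i = true ∧ (i : ℕ) < k + 1) ⊆
          insert ⟨k, hk⟩ (Finset.univ.filter fun i : Fin n => (s T).B i = true ∧ (i : ℕ) < k) := by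
        intro i hi
        simp only [Finset.mem_filter, Finset.mem_univ, true_and, Finset.mem_insert,
          Fin.ext_iff] at hi ⊢
        have := hi.2
        by_cases h : (i : ℕ) = k
        · exact Or.inl h
        · exact Or.inr ⟨hi.1, by omega⟩
      have hcard := (Finset.card_le_card hins).trans (Finset.card_insert_le _ _)
      have hmul := Nat.mul_le_mul_right w hcard
      rw [Nat.add_mul] at hmul
      have d1 := hammingDist_le_two_mul_sub (x := fun j => (s j).M) hM hta haT
      have d2 := hammingDist_le_two_mul_sub (x := fun j => (s j).M) hM hab hbT
      simp only [htM, haM, hbM, hBk] at d1 d2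
      rw [hammingDist_const_of_ne (by simp), Fintype.card_fin] at d1 d2
      omega
    · have hsub : (Finset.univ.filter fun i : Fin n => (s T).B i = true ∧ (i : ℕ) < k + 1) ⊆
          Finset.univ.filter fun i : Fin n => (s T).B i = true ∧ (i : ℕ) < k := by
        intro i hi
        simp only [Finset.mem_filter, Finset.mem_univ, true_and] at hi ⊢
        refine ⟨hi.1, lt_of_le_of_ne (by omega) fun h => hBk ?_⟩
        rw [← hi.1]
        congr 1
        exact Fin.ext h.symm
      have hmul := Nat.mul_le_mul_right w (Finset.card_le_card hsub)
      omega

/-- **Classical soundness of the amplified clock construction.**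
If `s₀, …, s_T` is a sequence of assignments starting at the all-zeros assignment,
where each step flips at most two bits, every assignment is valid, and the final
assignment has `B` of Hamming weight at least `g'` and `K_{4n} = 1`, then `T ≥ g'·w`. -/
theorem classical_soundness (n w g' : ℕ) (hn : 1 ≤ n) (hw : 1 ≤ w)
    (hg'1 : 1 ≤ g') (hg'n : g' ≤ n)
    (T : ℕ) (s : ℕ → ClAsn n w)
    (h0 : s 0 = ClAsn.zero n w)
    (hstep : ∀ j : ℕ, j < T → ClAsn.flips (s j) (s (j + 1)) ≤ 2)
    (hvalid : ∀ j : ℕ, j ≤ T → (s j).Valid)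
    (hweight : g' ≤ (Finset.univ.filter fun i => (s T).B i = true).card)
    (hfinal : (s T).K ⟨4 * n - 1, by omega⟩ = true) :
    g' * w ≤ T := by
  have hpos : (s T).pos = 4 * n := by
    refine le_antisymm (s T).pos_le (((hvalid T le_rfl).kb_iff (by omega) le_rfl).1 ?_)
    rw [ClAsn.kb, dif_pos (by omega)]
    exact hfinal
  obtain ⟨t, htT, -, -, ht⟩ := exists_cleared_time hn h0 hstep hvalid hpos n le_rfl
  simp only [Fin.is_lt, and_true] at ht
  exact (Nat.mul_le_mul_right w hweight).trans (ht.trans htT)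
end
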